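/- A point (u, v, a, b) ∈ ℝ⁴ with u ≥ 0 is an equilibrium of system (ham) (i.e., the vector field v, -(a² + b² - 1/4)·u, -a + u²·b, b - u²·a vanishes at it) if and only if it equals P₀ = (0,0,0,0), P₊ = (1, 0, 1/(2√2), 1/(2√2)), or P₋ = (1, 0, -1/(2√2), -1/(2√2)). Moreover H(P₀) = 0 and H(P₊) = H(P₋) = −1/8. -/

import Mathlib

/-- The Hamiltonian of system (ham). -/
noncomputable def hamH (u v a b : ℝ) : ℝ :=
  v ^ 2 / 2 + u ^ 2 / 2 * (a ^ 2 + b ^ 2 - 1 / 4) - a * b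

theorem inv_two_mul_sqrt_two_sq : (1 / (2 * Real.sqrt 2)) ^ 2 = 1 / 8 := by
  rw [div_pow, mul_pow, Real.sq_sqrt zero_le_two]
  norm_num

/-- A point `(u, v, a, b) ∈ ℝ⁴` with `u ≥ 0` is an equilibrium of system
(ham) iff it equals `P₀ = (0,0,0,0)`, `P₊ = (1, 0, 1/(2√2), 1/(2√2))`, or
`P₋ = (1, 0, -1/(2√2), -1/(2√2))`; moreover `H(P₀) = 0` and `H(P₊) = H(P₋) = −1/8`. -/
theorem ham_equilibria :
    (∀ u v a b : ℝ, 0 ≤ u →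
      ((v = 0 ∧ -(a ^ 2 + b ^ 2 - 1 / 4) * u = 0 ∧
        -a + u ^ 2 * b = 0 ∧ b - u ^ 2 * a = 0) ↔
       ((u, v, a, b) = ((0 : ℝ), (0 : ℝ), (0 : ℝ), (0 : ℝ)) ∨
        (u, v, a, b) = ((1 : ℝ), (0 : ℝ), 1 / (2 * Real.sqrt 2), 1 / (2 * Real.sqrt 2)) ∨
        (u, v, a, b) = ((1 : ℝ), (0 : ℝ), -(1 / (2 * Real.sqrt 2)), -(1 / (2 * Real.sqrt 2)))))) ∧
    hamH 0 0 0 0 = 0 ∧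
    hamH 1 0 (1 / (2 * Real.sqrt 2)) (1 / (2 * Real.sqrt 2)) = -(1 / 8) ∧
    hamH 1 0 (-(1 / (2 * Real.sqrt 2))) (-(1 / (2 * Real.sqrt 2))) = -(1 / 8) := by
  have hc := inv_two_mul_sqrt_two_sq
  generalize 1 / (2 * Real.sqrt 2) = c at hc ⊢
  refine ⟨fun u v a b hu => ⟨?_, ?_⟩, ?_, ?_, ?_⟩
  · rintro ⟨rfl, h₁, h₂, h₃⟩
    obtain rfl : b = u ^ 2 * a := by linarith
    have ha : a * (u ^ 4 - 1) = 0 := by linear_combination h₂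
    rcases mul_eq_zero.mp ha with rfl | hu₄
    · left
      obtain rfl : u = 0 := by linear_combination 4 * h₁
      simp
    · right
      obtain rfl : u = 1 := (pow_eq_one_iff_of_nonneg hu four_ne_zero).mp (sub_eq_zero.mp hu₄)
      have hac : a ^ 2 = c ^ 2 := by linear_combination -h₁ / 2 - hc
      rcases sq_eq_sq_iff_eq_or_eq_neg.mp hac with rfl | rfl <;> simp
  · simp only [Prod.mk.injEq]
    rintro (⟨rfl, rfl, rfl, rfl⟩ | ⟨rfl, rfl, rfl, rfl⟩ | ⟨rfl, rfl, rfl, rfl⟩)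
    · simp
    all_goals
      refine ⟨rfl, ?_, by ring, by ring⟩
      linear_combination -2 * hc
  · simp [hamH]
  all_goals
    unfold hamH
    ring
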